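/- arXiv:2012.10353 — 2 statements merged into one kernel-verified Lean document; each statement's English description precedes it below -/
import Mathlib

section
/- Let a and b be coprime positive integers and let d₀ ≥ 1 and 0 ≤ d₁ ≤ d₀ be integers; let g = gcd(d₀,d₁) (with the convention gcd(d₀,0) = d₀). Then in ℤ[t,t⁻¹] the product (t^{d₀} − t^{−d₀})·(t^{(a+b−1)d₀+d₁} − t^{−((a+b−1)d₀+d₁)}) divides (t − t^{−1})² · Σ_{k∣g} μ(k)·(−1)^{((a+b)d₀+d₁)/k} · [ ad₀/k choose (d₀−d₁)/k ]_{t^k} · [ ((a+b−1)d₀+d₁)/k choose ad₀/k ]_{t^k}. (This is Theorem 2.3 of the paper for the pair Y^{[2]}_{(a,b)}, i.e. integrality Ω_d(Y^{[2]}_{(a,b)})(q) ∈ ℤ[q^{±1/2}], using the closed form N^log_d(Y^{[2]}_{(a,b)})(q) = [ad₀ choose d₀−d₁]_q [ (a+b−1)d₀+d₁ choose ad₀ ]_q of equation (4.1), with d·D₁ = d₀ and d·D₂ = (a+b−1)d₀+d₁.) -/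
/-!
STATEMENT 2: BPS integrality for Y^{[2]}_{(a,b)} (Theorem 2.3 of the paper).
In ℤ[t,t⁻¹], with g = gcd(d₀,d₁), the product
(t^{d₀} − t^{−d₀})·(t^{(a+b−1)d₀+d₁} − t^{−((a+b−1)d₀+d₁)}) divides
(t − t^{−1})² · Σ_{k∣g} μ(k)·(−1)^{((a+b)d₀+d₁)/k}
  · [ ad₀/k choose (d₀−d₁)/k ]_{t^k} · [ ((a+b−1)d₀+d₁)/k choose ad₀/k ]_{t^k}.
-/

open Finset LaurentPolynomial ArithmeticFunction

noncomputable section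

/-- Gaussian binomial coefficient `C_q(n, m) ∈ ℤ[q]`, defined by the q-Pascal recursion
`C_q(n+1, m+1) = C_q(n, m) + q^{m+1}·C_q(n, m+1)`; it vanishes for `m > n`. -/
def gaussBinom : ℕ → ℕ → Polynomial ℤ
  | _, 0 => 1
  | 0, _ + 1 => 0
  | n + 1, m + 1 => gaussBinom n m + Polynomial.X ^ (m + 1) * gaussBinom n (m + 1)

/-- The symmetrised q-integer `[n]_t = t^n − t^{−n}` in `ℤ[t,t⁻¹]`. -/
def qint (n : ℤ) : LaurentPolynomial ℤ := T n - T (-n)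

/-- The symmetrised q-binomial with the substitution `t ↦ t^k`:
`[n choose m]_{t^k} = t^{−k·m·(n−m)} · C_{t^{2k}}(n, m)` in `ℤ[t,t⁻¹]`. -/
def symmBinom (k : ℤ) (n m : ℕ) : LaurentPolynomial ℤ :=
  T (-(k * (m : ℤ) * ((n - m : ℕ) : ℤ))) * Polynomial.aeval (T (2 * k)) (gaussBinom n m)

/-! ### Product formulas in `ℤ[t,t⁻¹]` -/

theorem gaussBinom_zero_right (n : ℕ) : gaussBinom n 0 = 1 := by
  cases n <;> rfl

theorem gaussBinom_succ_succ (n m : ℕ) :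
    gaussBinom (n + 1) (m + 1) =
      gaussBinom n m + Polynomial.X ^ (m + 1) * gaussBinom n (m + 1) := rfl

theorem gaussBinom_eq_zero_of_lt {n m : ℕ} (h : n < m) : gaussBinom n m = 0 := by
  induction n generalizing m with
  | zero =>
    obtain ⟨m, rfl⟩ := Nat.exists_eq_succ_of_ne_zero h.ne'
    rfl
  | succ n ih =>
    obtain ⟨m, rfl⟩ := Nat.exists_eq_succ_of_ne_zero (Nat.ne_zero_of_lt h)
    rw [Nat.succ_eq_add_one, gaussBinom_succ_succ, ih (by lia), ih (by lia)]
    simp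

theorem gaussBinom_self (n : ℕ) : gaussBinom n n = 1 := by
  induction n with
  | zero => rfl
  | succ n ih => simp [gaussBinom_succ_succ, ih, gaussBinom_eq_zero_of_lt]

theorem symmBinom_zero_right (k : ℤ) (n : ℕ) : symmBinom k n 0 = 1 := by
  simp [symmBinom, gaussBinom_zero_right]

theorem symmBinom_self (k : ℤ) (n : ℕ) : symmBinom k n n = 1 := by
  simp [symmBinom, gaussBinom_self]

theorem symmBinom_add (k : ℤ) (i j : ℕ) :
    symmBinom k (i + j) i =
      T (-(k * i * j)) * Polynomial.aeval (T (2 * k)) (gaussBinom (i + j) i) := by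
  simp [symmBinom]

/-- The symmetric Pascal rule. -/
theorem symmBinom_succ_succ (k : ℤ) (i j : ℕ) :
    symmBinom k (i + 1 + (j + 1)) (i + 1) =
      T (-(k * (j + 1))) * symmBinom k (i + (j + 1)) i +
        T (k * (i + 1)) * symmBinom k (i + 1 + j) (i + 1) := by
  have h : i + 1 + (j + 1) = (i + (j + 1)) + 1 := by ring
  have h' : i + 1 + j = i + (j + 1) := by ring
  rw [symmBinom_add, symmBinom_add, symmBinom_add, h, gaussBinom_succ_succ, h']
  simp only [map_add, map_mul, map_pow, Polynomial.aeval_X, T_pow, mul_add, ← mul_assoc, ← T_add]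
  push_cast
  ring_nf

/-- The `q`-factorial `[n]!` with `t` replaced by `t^k`. -/
def qfactorial (k : ℤ) (n : ℕ) : LaurentPolynomial ℤ := ∏ i ∈ range n, qint (k * (i + 1))

theorem qfactorial_succ (k : ℤ) (n : ℕ) :
    qfactorial k (n + 1) = qfactorial k n * qint (k * (n + 1)) :=
  prod_range_succ _ _

theorem qint_ne_zero {n : ℤ} (hn : n ≠ 0) : qint n ≠ 0 := by
  intro h
  have h' := congrArg LaurentPolynomial.degree (sub_eq_zero.mp h)
  simp only [LaurentPolynomial.degree_T, WithBot.coe_inj] at h'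
  lia

theorem qfactorial_ne_zero {k : ℤ} (hk : k ≠ 0) (n : ℕ) : qfactorial k n ≠ 0 :=
  prod_ne_zero_iff.mpr fun i _ => qint_ne_zero (mul_ne_zero hk (by lia))

theorem qint_add (m n : ℤ) : qint (m + n) = T (-n) * qint m + T m * qint n := by
  simp only [qint, mul_sub, ← T_add]
  ring_nf

theorem symmBinom_mul_qfactorial (k : ℤ) (i j : ℕ) :
    symmBinom k (i + j) i * (qfactorial k i * qfactorial k j) = qfactorial k (i + j) := by
  induction i generalizing j with
  | zero => simp [symmBinom_zero_right, qfactorial]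
  | succ i ihi =>
    induction j with
    | zero => simp [symmBinom_self, qfactorial]
    | succ j ihj =>
      have h := ihi (j + 1)
      have e1 : i + 1 + (j + 1) = (i + 1 + j) + 1 := by ring
      have e2 : i + (j + 1) = i + 1 + j := by ring
      have e3 : k * (((i + 1 + j : ℕ) : ℤ) + 1) = k * (i + 1) + k * (j + 1) := by
        push_cast; ring
      rw [symmBinom_succ_succ, e1, qfactorial_succ _ (i + 1 + j), e3, qint_add]
      rw [e2] at h ⊢
      calc _ = T (-(k * (j + 1))) * qint (k * (i + 1)) *
                (symmBinom k (i + 1 + j) i * (qfactorial k i * qfactorial k (j + 1))) +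
              T (k * (i + 1)) * qint (k * (j + 1)) *
                (symmBinom k (i + 1 + j) (i + 1) * (qfactorial k (i + 1) * qfactorial k j)) := by
            simp only [qfactorial_succ]; ring
        _ = _ := by rw [h, ihj]; ring

/-- The absorption identity. -/
theorem qint_mul_symmBinom (i j : ℕ) :
    qint (i + 1) * symmBinom 1 (i + 1 + j) (i + 1) =
      qint (i + 1 + j) * symmBinom 1 (i + j) i := by
  have h := symmBinom_mul_qfactorial 1 (i + 1) j
  have e : i + 1 + j = i + j + 1 := by ring
  rw [e, qfactorial_succ, qfactorial_succ, ← symmBinom_mul_qfactorial 1 i j] at h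
  refine mul_right_cancel₀ (mul_ne_zero (qfactorial_ne_zero one_ne_zero i)
    (qfactorial_ne_zero one_ne_zero j)) ?_
  simp only [one_mul] at h
  push_cast at h
  rw [e, show (i : ℤ) + 1 + j = i + j + 1 by ring]
  linear_combination h

/-- The product of the `q`-integers strictly between `j * e` and `(j + 1) * e`. -/
def qblock (e j : ℕ) : LaurentPolynomial ℤ := ∏ i ∈ range (e - 1), qint (j * e + (i + 1))

theorem qfactorial_mul {e : ℕ} (he : 0 < e) (n : ℕ) :
    qfactorial 1 (e * n) = (∏ j ∈ range n, qblock e j) * qfactorial e n := by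
  induction n with
  | zero => simp [qfactorial]
  | succ n ih =>
    obtain ⟨e, rfl⟩ := Nat.exists_eq_add_one.mpr he
    have h : qfactorial 1 ((e + 1) * (n + 1)) =
        qfactorial 1 ((e + 1) * n) * (qblock (e + 1) n * qint ((e + 1 : ℕ) * (n + 1))) := by
      rw [qfactorial, qfactorial, qblock, mul_add_one, prod_range_add, prod_range_succ]
      congr 2
      · refine prod_congr (by simp) fun i _ => ?_
        congr 1
        push_cast
        ring
      · congr 1
        push_cast
        ring
    rw [h, ih, prod_range_succ, qfactorial_succ]
    ring

theorem symmBinom_mul_qblock {e : ℕ} (he : 0 < e) (i j : ℕ) :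
    symmBinom 1 (e * i + e * j) (e * i) *
        ((∏ l ∈ range i, qblock e l) * ∏ l ∈ range j, qblock e l) =
      symmBinom e (i + j) i * ∏ l ∈ range (i + j), qblock e l := by
  have he' : (e : ℤ) ≠ 0 := by exact_mod_cast he.ne'
  refine mul_right_cancel₀ (mul_ne_zero (qfactorial_ne_zero he' i) (qfactorial_ne_zero he' j)) ?_
  have h := symmBinom_mul_qfactorial 1 (e * i) (e * j)
  rw [← mul_add, qfactorial_mul he, qfactorial_mul he, qfactorial_mul he, mul_add,
    ← symmBinom_mul_qfactorial e i j] at h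
  linear_combination h

/-! ### Evaluation at a unit -/

section Evaluation

variable {R : Type*} [CommRing R]

/-- Evaluation of an integral Laurent polynomial at a unit. -/
def evalUnit (x : Rˣ) : LaurentPolynomial ℤ →+* R := LaurentPolynomial.eval₂ (Int.castRingHom R) x

@[simp]
theorem evalUnit_T (x : Rˣ) (n : ℤ) : evalUnit x (T n) = ((x ^ n : Rˣ) : R) :=
  LaurentPolynomial.eval₂_T _ _ _

theorem evalUnit_qint (x : Rˣ) (n : ℤ) :
    evalUnit x (qint n) = ((x ^ n : Rˣ) : R) - ((x ^ (-n) : Rˣ) : R) := by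
  simp [qint]

theorem evalUnit_symmBinom (x : Rˣ) (k : ℤ) (n m : ℕ) :
    evalUnit x (symmBinom k n m) = ((x ^ (-(k * m * (n - m : ℕ))) : Rˣ) : R) *
      Polynomial.aeval ((x ^ (2 * k) : Rˣ) : R) (gaussBinom n m) := by
  rw [symmBinom, map_mul, evalUnit_T, Polynomial.aeval_def, Polynomial.hom_eval₂, evalUnit_T,
    Polynomial.aeval_def]
  congr 2
  exact RingHom.ext_int _ _

theorem evalUnit_symmBinom_eq_zpow (x : Rˣ) (k : ℤ) (n m : ℕ) :
    evalUnit x (symmBinom k n m) = evalUnit (x ^ k) (symmBinom 1 n m) := by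
  rw [evalUnit_symmBinom, evalUnit_symmBinom, ← zpow_mul, ← zpow_mul]
  ring_nf

theorem aeval_gaussBinom_one_add {δ : R} (hδ : δ * δ = 0) (i j : ℕ) :
    Polynomial.aeval (1 + 2 * δ) (gaussBinom (i + j) i) = ((i + j).choose i : R) * (1 + i * j * δ) := by
  induction i generalizing j with
  | zero => simp [gaussBinom_zero_right]
  | succ i ihi =>
    induction j with
    | zero => simp [gaussBinom_self]
    | succ j ihj =>
      have e1 : i + 1 + (j + 1) = (i + (j + 1)) + 1 := by ring
      have e2 : i + 1 + j = i + (j + 1) := by ring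
      have hpow : ∀ n : ℕ, (1 + 2 * δ) ^ n = 1 + 2 * n * δ := by
        intro n
        induction n with
        | zero => simp
        | succ n ih => rw [pow_succ, ih]; push_cast; linear_combination (4 * n) * hδ
      have hc : ((i + 1 : ℕ) : R) * ((i + (j + 1)).choose (i + 1) : R) =
          ((j + 1 : ℕ) : R) * ((i + (j + 1)).choose i : R) := by
        have := Nat.choose_succ_right_eq (i + (j + 1)) i
        rw [Nat.add_sub_cancel_left] at this
        have h' := congrArg (Nat.cast (R := R)) this
        push_cast at h' ⊢
        linear_combination h'
      rw [e2] at ihj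
      rw [e1, gaussBinom_succ_succ, map_add, map_mul, map_pow, Polynomial.aeval_X, ihi, ihj, hpow,
        Nat.choose_succ_succ]
      push_cast at hc ⊢
      linear_combination δ * hc + ((i + (j + 1)).choose (i + 1) : R) * 2 * (i + 1) * (i + 1) * j * hδ

/-- If `x ^ e = ± (1 + δ)` with `δ ^ 2 = 0`, then `[i + j choose i]` at `x ^ e` is an ordinary
binomial coefficient up to sign. -/
theorem evalUnit_symmBinom_of_sq_zero {x : Rˣ} {e : ℕ} {s δ : R} (hs : s * s = 1)
    (hδ : δ * δ = 0) (hx : (x : R) ^ e = s * (1 + δ)) (i j : ℕ) :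
    evalUnit x (symmBinom e (i + j) i) = s ^ (i * j) * ((i + j).choose i : R) := by
  have hpow : ∀ n : ℕ, (1 + δ) ^ n = 1 + n * δ := by
    intro n
    induction n with
    | zero => simp
    | succ n ih => rw [pow_succ, ih]; push_cast; linear_combination n * hδ
  have h2 : ((x ^ (2 * (e : ℤ)) : Rˣ) : R) = 1 + 2 * δ := by
    rw [mul_comm, zpow_mul, zpow_natCast, zpow_ofNat, Units.val_pow_eq_pow_val,
      Units.val_pow_eq_pow_val, hx]
    linear_combination (1 + δ) ^ 2 * hs + hδ
  have hss : s ^ (i * j) * s ^ (i * j) = 1 := by rw [← mul_pow, hs, one_pow]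
  have h1 : ((x ^ (-((e : ℤ) * i * j)) : Rˣ) : R) = s ^ (i * j) * (1 - i * j * δ) := by
    rw [zpow_neg]
    refine Units.inv_eq_of_mul_eq_one_right ?_
    have : ((e : ℤ) * i * j) = ((e * (i * j) : ℕ) : ℤ) := by push_cast; ring
    rw [this, zpow_natCast, Units.val_pow_eq_pow_val, pow_mul, hx, mul_pow, hpow]
    push_cast
    linear_combination (1 + i * j * δ) * (1 - i * j * δ) * hss - (i * j : R) ^ 2 * hδ
  rw [evalUnit_symmBinom, h2, Nat.add_sub_cancel_left, aeval_gaussBinom_one_add hδ, h1]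
  linear_combination -s ^ (i * j) * ((i + j).choose i : R) * (i * j) ^ 2 * hδ

end Evaluation

/-! ### Second-order evaluation at roots of unity -/

section SquareZero

variable {R : Type*} [CommRing R] {x : Rˣ} {e : ℕ} {s δ : R}

theorem val_zpow_mul_of_sq_zero (hs : s * s = 1) (hδ : δ * δ = 0)
    (hx : (x : R) ^ e = s * (1 + δ)) (j : ℕ) :
    ((x ^ ((j : ℤ) * e) : Rˣ) : R) = s ^ j * (1 + j * δ) ∧
      ((x ^ (-((j : ℤ) * e)) : Rˣ) : R) = s ^ j * (1 - j * δ) := by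
  have hpow : (1 + δ) ^ j = 1 + j * δ := by
    induction j with
    | zero => simp
    | succ n ih => rw [pow_succ, ih]; push_cast; linear_combination n * hδ
  have hss : s ^ j * s ^ j = 1 := by rw [← mul_pow, hs, one_pow]
  have h1 : ((x ^ ((j : ℤ) * e) : Rˣ) : R) = s ^ j * (1 + j * δ) := by
    rw [mul_comm, zpow_mul, zpow_natCast, zpow_natCast, Units.val_pow_eq_pow_val,
      Units.val_pow_eq_pow_val, hx, mul_pow, hpow]
  refine ⟨h1, ?_⟩
  rw [zpow_neg]
  refine Units.inv_eq_of_mul_eq_one_right ?_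
  rw [h1]
  linear_combination (1 + j * δ) * (1 - j * δ) * hss - (j : R) ^ 2 * hδ

theorem evalUnit_qint_add (hs : s * s = 1) (hδ : δ * δ = 0)
    (hx : (x : R) ^ e = s * (1 + δ)) (j : ℕ) (i : ℤ) :
    evalUnit x (qint (j * e + i)) = s ^ j * (evalUnit x (qint i) +
      j * δ * (((x ^ i : Rˣ) : R) + ((x ^ (-i) : Rˣ) : R))) := by
  obtain ⟨h1, h2⟩ := val_zpow_mul_of_sq_zero hs hδ hx j
  rw [evalUnit_qint, evalUnit_qint, neg_add, zpow_add, zpow_add, Units.val_mul, Units.val_mul,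
    h1, h2]
  ring

theorem evalUnit_qint_mul_reflect (hs : s * s = 1) (hδ : δ * δ = 0)
    (hx : (x : R) ^ e = s * (1 + δ)) (j : ℕ) (i : ℤ) :
    evalUnit x (qint (j * e + i)) * evalUnit x (qint (j * e + (e - i))) =
      evalUnit x (qint i) * evalUnit x (qint (e - i)) := by
  have hss : s ^ j * s ^ j = 1 := by rw [← mul_pow, hs, one_pow]
  have h := evalUnit_qint_add hs hδ hx j i
  have h' := evalUnit_qint_add hs hδ hx (j + 1) (-i)
  have h'' := evalUnit_qint_add hs hδ hx 1 (-i)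
  have hneg : evalUnit x (qint (-i)) = -evalUnit x (qint i) := by simp [evalUnit_qint]
  rw [show ((j + 1 : ℕ) : ℤ) * e + -i = j * e + (e - i) by push_cast; ring, hneg, neg_neg] at h'
  rw [show ((1 : ℕ) : ℤ) * e + -i = e - i by push_cast; ring, hneg, neg_neg] at h''
  rw [h, h', h'']
  push_cast
  set c := ((x ^ i : Rˣ) : R) + ((x ^ (-i) : Rˣ) : R) with hc
  rw [show ((x ^ (-i) : Rˣ) : R) + ((x ^ i : Rˣ) : R) = c by rw [hc, add_comm]]
  set H := evalUnit x (qint i)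
  rw [pow_succ]
  linear_combination s * (H + j * δ * c) * (-H + (j + 1) * δ * c) * hss +
    s * c ^ 2 * j * (j + 1) * hδ

theorem evalUnit_qblock_sq (hs : s * s = 1) (hδ : δ * δ = 0)
    (hx : (x : R) ^ e = s * (1 + δ)) (j : ℕ) :
    evalUnit x (qblock e j) ^ 2 = evalUnit x (qblock e 0) ^ 2 := by
  have key : ∀ j : ℕ, evalUnit x (qblock e j) ^ 2 = ∏ i ∈ range (e - 1),
      evalUnit x (qint ((i : ℤ) + 1)) * evalUnit x (qint (e - ((i : ℤ) + 1))) := by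
    intro j
    have hr : evalUnit x (qblock e j) =
        ∏ i ∈ range (e - 1), evalUnit x (qint (j * e + (e - ((i : ℤ) + 1)))) := by
      rw [qblock, map_prod, ← prod_range_reflect]
      refine prod_congr rfl fun i hi => ?_
      have hi := mem_range.mp hi
      congr 3
      lia
    rw [sq]
    nth_rewrite 2 [hr]
    rw [qblock, map_prod, ← prod_mul_distrib]
    exact prod_congr rfl fun i _ => evalUnit_qint_mul_reflect hs hδ hx j _
  rw [key, key]

end SquareZero

section DualNumber

open TrivSqZeroExt

variable {x : (DualNumber ℂ)ˣ} {e : ℕ}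

theorem fst_pow_mul_self (hp : IsPrimitiveRoot ((x : DualNumber ℂ).fst ^ 2) e) :
    (x : DualNumber ℂ).fst ^ e * (x : DualNumber ℂ).fst ^ e = 1 := by
  rw [← hp.pow_eq_one, ← pow_mul, mul_comm 2, pow_mul, sq]

/-- The unit `x ^ e` is a sign times a unipotent element. -/
theorem exists_val_pow_eq (hp : IsPrimitiveRoot ((x : DualNumber ℂ).fst ^ 2) e) :
    ∃ δ : DualNumber ℂ, δ.fst = 0 ∧ δ * δ = 0 ∧
      (x : DualNumber ℂ) ^ e = inl ((x : DualNumber ℂ).fst ^ e) * (1 + δ) := by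
  have h := fst_pow_mul_self hp
  have hf : (inl ((x : DualNumber ℂ).fst ^ e) * (x : DualNumber ℂ) ^ e - 1).fst = 0 := by
    simp [h]
  refine ⟨inl ((x : DualNumber ℂ).fst ^ e) * (x : DualNumber ℂ) ^ e - 1, hf, ?_, ?_⟩
  · ext <;> simp only [fst_mul, snd_mul, hf] <;> simp
  · rw [add_sub_cancel, ← mul_assoc, ← inl_mul, h, inl_one, one_mul]

theorem fst_evalUnit_qint_eq_zero_iff (hp : IsPrimitiveRoot ((x : DualNumber ℂ).fst ^ 2) e)
    (n : ℕ) : (evalUnit x (qint n)).fst = 0 ↔ e ∣ n := by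
  have h1 : (((x ^ (n : ℤ) : (DualNumber ℂ)ˣ) : DualNumber ℂ) *
      ((x ^ (-(n : ℤ)) : (DualNumber ℂ)ˣ) : DualNumber ℂ)).fst = 1 := by
    rw [← Units.val_mul, ← zpow_add]
    simp
  rw [fst_mul, zpow_natCast, Units.val_pow_eq_pow_val, fst_pow] at h1
  rw [← hp.pow_eq_one_iff_dvd, ← pow_mul, mul_comm 2, pow_mul, sq, evalUnit_qint, fst_sub,
    sub_eq_zero, zpow_natCast, Units.val_pow_eq_pow_val, fst_pow]
  constructor
  · intro h0
    rwa [← h0] at h1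
  · intro h0
    exact mul_left_cancel₀ (left_ne_zero_of_mul_eq_one h0) (h0.trans h1.symm)

theorem isUnit_evalUnit_qblock (hp : IsPrimitiveRoot ((x : DualNumber ℂ).fst ^ 2) e) (j : ℕ) :
    IsUnit (evalUnit x (qblock e j)) := by
  rw [qblock, map_prod]
  refine IsUnit.prod_iff.mpr fun i hi => ?_
  have hlt : i + 1 < e := by have := mem_range.mp hi; lia
  have h := (fst_evalUnit_qint_eq_zero_iff hp (j * e + (i + 1))).not.mpr (by
    rw [Nat.dvd_add_right (Dvd.intro_left _ rfl)]
    exact Nat.not_dvd_of_pos_of_lt i.succ_pos hlt)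
  rw [isUnit_iff_isUnit_fst, isUnit_iff_ne_zero]
  simpa using h

theorem evalUnit_qblock (hp : IsPrimitiveRoot ((x : DualNumber ℂ).fst ^ 2) e)
    (j : ℕ) :
    evalUnit x (qblock e j) =
      inl ((x : DualNumber ℂ).fst ^ e) ^ (j * (e - 1)) * evalUnit x (qblock e 0) := by
  obtain ⟨δ, hδf, hδ, hx⟩ := exists_val_pow_eq hp
  set s : DualNumber ℂ := inl ((x : DualNumber ℂ).fst ^ e) with hs_def
  have hs : s * s = 1 := by rw [hs_def, ← inl_mul, fst_pow_mul_self hp, inl_one]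
  have hss : s ^ (j * (e - 1)) * s ^ (j * (e - 1)) = 1 := by rw [← mul_pow, hs, one_pow]
  have hsq := evalUnit_qblock_sq hs hδ hx j
  have hfst : (evalUnit x (qblock e j)).fst =
      (s ^ (j * (e - 1)) * evalUnit x (qblock e 0)).fst := by
    have hmap : ∀ f : DualNumber ℂ, f.fst = fstHom ℂ ℂ ℂ f := fun _ => rfl
    rw [hmap, hmap, map_mul, qblock, qblock, map_prod, map_prod, map_prod, map_prod, pow_mul,
      map_pow, ← card_range (e - 1), ← prod_const, card_range, ← prod_mul_distrib]
    refine prod_congr rfl fun i _ => ?_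
    rw [evalUnit_qint_add hs hδ hx]
    simp [hδf]
  have hsum : IsUnit (evalUnit x (qblock e j) + s ^ (j * (e - 1)) * evalUnit x (qblock e 0)) := by
    rw [isUnit_iff_isUnit_fst, fst_add, hfst, ← two_mul, isUnit_iff_ne_zero]
    have hu : IsUnit (s ^ (j * (e - 1)) * evalUnit x (qblock e 0)) :=
      (IsUnit.of_mul_eq_one _ hss).mul (isUnit_evalUnit_qblock hp 0)
    exact mul_ne_zero two_ne_zero (isUnit_iff_isUnit_fst.mp hu).ne_zero
  refine sub_eq_zero.mp (hsum.mul_left_eq_zero.mp ?_)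
  linear_combination hsq - evalUnit x (qblock e 0) ^ 2 * hss

/-- To second order at a root of unity, a `q`-binomial coefficient with entries divisible by the
order is an ordinary binomial coefficient up to sign. -/
theorem evalUnit_symmBinom_mul (he : 0 < e)
    (hp : IsPrimitiveRoot ((x : DualNumber ℂ).fst ^ 2) e) (i j : ℕ) :
    evalUnit x (symmBinom 1 (e * i + e * j) (e * i)) =
      inl ((x : DualNumber ℂ).fst ^ e) ^ (e * (i * j)) * ((i + j).choose i : DualNumber ℂ) := by
  obtain ⟨δ, hδf, hδ, hx⟩ := exists_val_pow_eq hp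
  have hB := evalUnit_qblock hp
  set s : DualNumber ℂ := inl ((x : DualNumber ℂ).fst ^ e) with hs_def
  have hs : s * s = 1 := by rw [hs_def, ← inl_mul, fst_pow_mul_self hp, inl_one]
  have hunit : ∀ n, IsUnit (∏ l ∈ range n, evalUnit x (qblock e l)) := fun n =>
    IsUnit.prod_iff.mpr fun j _ => isUnit_evalUnit_qblock hp j
  have hD : ∏ l ∈ range (i + j), evalUnit x (qblock e l) = s ^ ((e - 1) * (i * j)) *
      ((∏ l ∈ range i, evalUnit x (qblock e l)) * ∏ l ∈ range j, evalUnit x (qblock e l)) := by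
    induction j with
    | zero => simp
    | succ j ih =>
      rw [← add_assoc, prod_range_succ, prod_range_succ, ih, hB (i + j), hB j]
      ring
  have h := congrArg (evalUnit x) (symmBinom_mul_qblock he i j)
  simp only [map_mul, map_prod] at h
  rw [hD, evalUnit_symmBinom_of_sq_zero hs hδ hx] at h
  refine ((hunit i).mul (hunit j)).mul_left_injective ?_
  simp only
  rw [h]
  obtain ⟨f, rfl⟩ := Nat.exists_eq_add_one.mpr he
  rw [Nat.add_sub_cancel]
  ring

end DualNumber

/-! ### Divisibility by double evaluation -/

section Divisibility

open Polynomial in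
theorem toLaurent_X_pow_sub_one (n : ℕ) :
    toLaurent (X ^ (2 * n) - 1 : ℤ[X]) = T n * qint n := by
  rw [map_sub, toLaurent_X_pow, map_one, qint, mul_sub, ← T_add, ← T_add, add_neg_cancel, T_zero]
  push_cast
  rw [two_mul]

open Polynomial in
theorem count_roots_X_pow_sub_one_le {n : ℕ} (hn : 0 < n) (ζ : ℂ) :
    (X ^ n - 1 : ℂ[X]).roots.count ζ ≤ if ζ ^ n = 1 then 1 else 0 := by
  split_ifs with h
  · have hsep : (X ^ n - 1 : ℂ[X]).Separable := by
      have := separable_X_pow_sub_C (1 : ℂ) (Nat.cast_ne_zero.mpr hn.ne') one_ne_zero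
      rwa [C_1] at this
    exact Multiset.nodup_iff_count_le_one.mp (nodup_roots hsep) ζ
  · refine (Multiset.count_eq_zero.mpr fun hm => h ?_).le
    have := isRoot_of_mem_roots hm
    simpa [sub_eq_zero] using this

open Polynomial TrivSqZeroExt in
theorem evalUnit_toLaurent_of_val_eq {x : (DualNumber ℂ)ˣ} {ζ : ℂ}
    (hx : (x : DualNumber ℂ) = inl ζ + inr 1) (p : ℤ[X]) :
    evalUnit x (toLaurent p) = inl ((p.map (Int.castRingHom ℂ)).eval ζ) +
      inr ((derivative (p.map (Int.castRingHom ℂ))).eval ζ) := by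
  have h1 : evalUnit x (toLaurent p) =
      aeval (x : DualNumber ℂ) (p.map (Int.castRingHom ℂ)) := by
    rw [evalUnit, LaurentPolynomial.eval₂_toLaurent, aeval_def, eval₂_map]
    congr 1
  have h2 : ∀ r : ℂ[X], aeval (inl ζ : DualNumber ℂ) r = inl (r.eval ζ) :=
    aeval_algebraMap_apply_eq_algebraMap_eval ζ
  rw [h1, hx, aeval_add_of_sq_eq_zero _ _ _ (by rw [sq, inr_mul_inr]), h2, h2]
  congr 1
  ext <;> simp

open Polynomial TrivSqZeroExt in
/-- Divisibility by `[m] * [n]` is tested at first order at the common roots of unity and at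
order zero at the other ones. -/
theorem qint_mul_qint_dvd {m n : ℕ} (hm : 0 < m) (hn : 0 < n) (f : LaurentPolynomial ℤ)
    (h : ∀ x : (DualNumber ℂ)ˣ, (x : DualNumber ℂ).fst ^ 2 ≠ 1 →
      (((x : DualNumber ℂ).fst ^ 2) ^ m = 1 → ((x : DualNumber ℂ).fst ^ 2) ^ n = 1 →
        evalUnit x f = 0) ∧
      (((x : DualNumber ℂ).fst ^ 2) ^ m = 1 ∨ ((x : DualNumber ℂ).fst ^ 2) ^ n = 1 →
        (evalUnit x f).fst = 0)) :
    qint m * qint n ∣ qint 1 ^ 2 * f := by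
  obtain ⟨r, q, hq⟩ := f.exists_T_pow
  suffices hdvd : (X ^ (2 * m) - 1) * (X ^ (2 * n) - 1) ∣ (X ^ (2 * 1) - 1) ^ 2 * q by
    have h' := map_dvd (toLaurent (R := ℤ)) hdvd
    rw [map_mul, map_mul, map_pow, toLaurent_X_pow_sub_one, toLaurent_X_pow_sub_one,
      toLaurent_X_pow_sub_one, hq] at h'
    rw [show (T m * qint m * (T n * qint n) : LaurentPolynomial ℤ) =
        (T m * T n) * (qint m * qint n) by ring,
      show ((T (1 : ℕ) * qint (1 : ℕ)) ^ 2 * (f * T r) : LaurentPolynomial ℤ) =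
        (T (1 : ℕ) ^ 2 * T r) * (qint 1 ^ 2 * f) by push_cast; ring] at h'
    rwa [IsUnit.mul_left_dvd ((isUnit_T _).mul (isUnit_T _)),
      IsUnit.dvd_mul_left (((isUnit_T _).pow 2).mul (isUnit_T _))] at h'
  have hmonic : ∀ k : ℕ, 0 < k → (X ^ (2 * k) - 1 : ℤ[X]).Monic := fun k hk =>
    monic_X_pow_sub_C (R := ℤ) 1 (by lia)
  have hne : ∀ k : ℕ, 0 < k → (X ^ (2 * k) - 1 : ℂ[X]) ≠ 0 := fun k hk =>
    (monic_X_pow_sub_C (R := ℂ) 1 (by lia)).ne_zero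
  rw [← map_dvd_map (Int.castRingHom ℂ) Int.cast_injective ((hmonic m hm).mul (hmonic n hn))]
  simp only [Polynomial.map_mul, Polynomial.map_sub, Polynomial.map_pow, map_X,
    Polynomial.map_one]
  set p : ℂ[X] := q.map (Int.castRingHom ℂ) with hp
  by_cases hp0 : p = 0
  · simp [hp0]
  have h1 : (X ^ (2 * 1) - 1 : ℂ[X]) ^ 2 ≠ 0 := pow_ne_zero _ (hne 1 one_pos)
  rw [IsAlgClosed.dvd_iff_roots_le_roots (mul_ne_zero (hne m hm) (hne n hn))
    (mul_ne_zero h1 hp0), roots_mul (mul_ne_zero (hne m hm) (hne n hn)),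
    roots_mul (mul_ne_zero h1 hp0), Multiset.le_iff_count]
  intro ζ
  rw [Multiset.count_add, Multiset.count_add]
  have hcm := count_roots_X_pow_sub_one_le (n := 2 * m) (by lia) ζ
  have hcn := count_roots_X_pow_sub_one_le (n := 2 * n) (by lia) ζ
  by_cases hζ2 : ζ ^ 2 = 1
  · have : 1 ≤ (X ^ (2 * 1) - 1 : ℂ[X]).roots.count ζ := by
      rw [Multiset.one_le_count_iff_mem, mem_roots (hne 1 one_pos)]
      simp [hζ2]
    rw [roots_pow, Multiset.count_nsmul]
    split_ifs at hcm hcn <;> lia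
  by_cases hζ0 : ζ = 0
  · have h0m : ζ ^ (2 * m) ≠ 1 := by rw [hζ0, zero_pow (by lia)]; exact zero_ne_one
    have h0n : ζ ^ (2 * n) ≠ 1 := by rw [hζ0, zero_pow (by lia)]; exact zero_ne_one
    rw [if_neg h0m] at hcm
    rw [if_neg h0n] at hcn
    lia
  have hxu : IsUnit (inl ζ + inr 1 : DualNumber ℂ) := by
    rw [isUnit_iff_isUnit_fst]
    simpa using hζ0
  obtain ⟨x, hx⟩ := hxu
  have hxf : (x : DualNumber ℂ).fst = ζ := by simp [hx]
  obtain ⟨hboth, hone⟩ := h x (by rwa [hxf])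
  have hev := evalUnit_toLaurent_of_val_eq hx q
  rw [← hp, hq, map_mul] at hev
  rw [hxf, ← pow_mul, ← pow_mul] at hboth hone
  rw [count_roots p]
  have hle2 : ζ ^ (2 * m) = 1 → ζ ^ (2 * n) = 1 → 2 ≤ p.rootMultiplicity ζ := by
    intro h2m h2n
    rw [hboth h2m h2n, zero_mul] at hev
    refine (one_lt_rootMultiplicity_iff_isRoot hp0).mpr ⟨?_, ?_⟩
    · simpa using (congrArg fst hev).symm
    · simpa using (congrArg snd hev).symm
  have hle1 : ζ ^ (2 * m) = 1 ∨ ζ ^ (2 * n) = 1 → 1 ≤ p.rootMultiplicity ζ := by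
    intro hor
    refine (rootMultiplicity_pos hp0).mpr ?_
    have := congrArg fst hev
    rw [fst_mul, hone hor, zero_mul] at this
    simpa using this.symm
  by_cases h2m : ζ ^ (2 * m) = 1 <;> by_cases h2n : ζ ^ (2 * n) = 1 <;>
    simp only [h2m, h2n, if_true, if_false, true_or, or_true, forall_const] at hcm hcn hle1 hle2 <;>
    lia

end Divisibility

/-! ### Cancellation in Möbius sums -/

theorem sum_moebius_mul_eq_zero {R : Type*} [CommRing R] {g p : ℕ} (hg : g ≠ 0)
    (hp : p.Prime) (hpg : p ∣ g) (G : ℕ → R)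
    (hG : ∀ k, p * k ∣ g → ¬p ∣ k → G (p * k) = G k) :
    ∑ k ∈ g.divisors, ((moebius k : ℤ) : R) * G k = 0 := by
  have hmu : ∀ k, ¬p ∣ k → moebius (p * k) = -moebius k := fun k hk => by
    rw [isMultiplicative_moebius.map_mul_of_coprime ((hp.coprime_iff_not_dvd).mpr hk),
      moebius_apply_prime hp, neg_one_mul]
  have hsq : ∑ k ∈ g.divisors with Squarefree k, ((moebius k : ℤ) : R) * G k =
      ∑ k ∈ g.divisors, ((moebius k : ℤ) : R) * G k := by
    refine sum_filter_of_ne fun k _ hk => ?_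
    rw [← moebius_ne_zero_iff_squarefree]
    rintro h0
    simp [h0] at hk
  rw [← hsq]
  have hquot : ∀ k, Squarefree (p * k) → ¬p ∣ k := by
    rintro k hk ⟨l, rfl⟩
    exact hp.one_lt.ne' (Nat.isUnit_iff.mp (hk p ⟨l, by ring⟩))
  have hcop : ∀ k, ¬p ∣ k → k ∣ g → p * k ∣ g := fun k hk hkg =>
    ((hp.coprime_iff_not_dvd).mpr hk).mul_dvd_of_dvd_of_dvd hpg hkg
  refine sum_involution (fun k _ => if p ∣ k then k / p else p * k) ?_ ?_ ?_ ?_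
  · intro k hk
    obtain ⟨hkg, hksq⟩ := mem_filter.mp hk
    have hkg := Nat.dvd_of_mem_divisors hkg
    by_cases hpk : p ∣ k
    · obtain ⟨l, rfl⟩ := hpk
      have hl := hquot l hksq
      simp only [dvd_mul_right, if_true, Nat.mul_div_cancel_left l hp.pos]
      rw [hG l hkg hl, hmu l hl]
      push_cast
      ring
    · simp only [hpk, if_false]
      rw [hG k (hcop k hpk hkg) hpk, hmu k hpk]
      push_cast
      ring
  · intro k hk _
    obtain ⟨hkg, hksq⟩ := mem_filter.mp hk
    have hk0 := hksq.ne_zero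
    by_cases hpk : p ∣ k
    · simp only [hpk, if_true]
      exact (Nat.div_lt_self (Nat.pos_of_ne_zero hk0) hp.one_lt).ne
    · simp only [hpk, if_false]
      exact fun h => hpk ⟨k, h.symm⟩
  · intro k hk
    obtain ⟨hkg, hksq⟩ := mem_filter.mp hk
    have hkg := Nat.dvd_of_mem_divisors hkg
    rw [mem_filter, Nat.mem_divisors]
    by_cases hpk : p ∣ k
    · simp only [hpk, if_true]
      exact ⟨⟨(Nat.div_dvd_of_dvd hpk).trans hkg, hg⟩,
        hksq.squarefree_of_dvd (Nat.div_dvd_of_dvd hpk)⟩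
    · simp only [hpk, if_false]
      exact ⟨⟨hcop k hpk hkg, hg⟩, (Nat.squarefree_mul ((hp.coprime_iff_not_dvd).mpr hpk)).mpr
        ⟨hp.prime.squarefree, hksq⟩⟩
  · intro k hk
    obtain ⟨hkg, hksq⟩ := mem_filter.mp hk
    by_cases hpk : p ∣ k
    · obtain ⟨l, rfl⟩ := hpk
      have hl := hquot l hksq
      simp [Nat.mul_div_cancel_left l hp.pos, hl]
    · simp [hpk, Nat.mul_div_cancel_left k hp.pos]

/-! ### The summands -/

section Summand

open TrivSqZeroExt

/-- The `k`-th summand, stripped of its Möbius factor, is this Laurent polynomial at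
`(d₀ / k, d₁ / k)` with `t` replaced by `t ^ k`. -/
def bpsTerm (a b d₀ d₁ : ℕ) : LaurentPolynomial ℤ :=
  (-1) ^ ((a + b) * d₀ + d₁) * symmBinom 1 (a * d₀) (d₀ - d₁) *
    symmBinom 1 ((a + b - 1) * d₀ + d₁) (a * d₀)

variable {x : (DualNumber ℂ)ˣ} {e : ℕ}

theorem fst_evalUnit_symmBinom_eq_zero (hp : IsPrimitiveRoot ((x : DualNumber ℂ).fst ^ 2) e)
    {n m : ℕ} (hmn : m ≤ n) (hn : e ∣ n) (hm : ¬e ∣ m) :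
    (evalUnit x (symmBinom 1 n m)).fst = 0 := by
  obtain ⟨m, rfl⟩ := Nat.exists_eq_succ_of_ne_zero (show m ≠ 0 by rintro rfl; simp at hm)
  obtain ⟨j, rfl⟩ := Nat.exists_eq_add_of_le hmn
  have h := congrArg (fun f => (evalUnit x f).fst) (qint_mul_symmBinom m j)
  have h0 := (fst_evalUnit_qint_eq_zero_iff hp _).mpr hn
  have h1 := (fst_evalUnit_qint_eq_zero_iff hp _).not.mpr hm
  push_cast at h0 h1
  simp only [map_mul, fst_mul, h0, zero_mul] at h
  exact (mul_eq_zero.mp h).resolve_left h1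

theorem fst_evalUnit_bpsTerm_eq_zero (hp : IsPrimitiveRoot ((x : DualNumber ℂ).fst ^ 2) e)
    {a b d₀ d₁ : ℕ} (ha : 0 < a) (hb : 0 < b) (hab : a.Coprime b) (hd : d₁ ≤ d₀)
    (h : e ∣ d₀ ∨ e ∣ (a + b - 1) * d₀ + d₁)
    (h' : ¬(e ∣ d₀ ∧ e ∣ (a + b - 1) * d₀ + d₁)) :
    (evalUnit x (bpsTerm a b d₀ d₁)).fst = 0 := by
  obtain ⟨a, rfl⟩ := Nat.exists_eq_add_one.mpr ha
  obtain ⟨b, rfl⟩ := Nat.exists_eq_add_one.mpr hb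
  obtain ⟨c, rfl⟩ := Nat.exists_eq_add_of_le hd
  have hN : (a + 1 + (b + 1) - 1) * (d₁ + c) + d₁ = (a + 1) * (d₁ + c) + (b * (d₁ + c) + d₁) := by
    rw [show a + 1 + (b + 1) - 1 = a + 1 + b by lia]
    ring
  have hle : c ≤ (a + 1) * (d₁ + c) := by nlinarith
  rw [bpsTerm]
  simp only [Nat.add_sub_cancel_left, map_mul, fst_mul]
  rw [hN] at h h' ⊢
  rcases h with h | h
  · have hA : e ∣ (a + 1) * (d₁ + c) := h.mul_left _
    have hc : ¬e ∣ c := fun hc => h' ⟨h, (Nat.dvd_add_right hA).mpr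
      ((Nat.dvd_add_right (h.mul_left _)).mpr ((Nat.dvd_add_left hc).mp h))⟩
    rw [fst_evalUnit_symmBinom_eq_zero hp hle hA hc]
    simp
  · by_cases hA : e ∣ (a + 1) * (d₁ + c)
    · have hc : ¬e ∣ c := by
        intro hc
        refine h' ⟨?_, h⟩
        have hB : e ∣ (b + 1) * (d₁ + c) := by
          have := (Nat.dvd_add_right hA).mp h
          rw [show (b + 1) * (d₁ + c) = b * (d₁ + c) + d₁ + c by ring]
          exact this.add hc
        have := Nat.dvd_gcd hA hB
        rwa [Nat.gcd_mul_right, hab.gcd_eq_one, one_mul] at this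
      rw [fst_evalUnit_symmBinom_eq_zero hp hle hA hc]
      simp
    · rw [fst_evalUnit_symmBinom_eq_zero hp (Nat.le_add_right _ _) h hA]
      simp

/-- The exponent of the sign contributed by the two `q`-binomial coefficients. -/
def bpsSignExponent (a b u₀ u₁ : ℕ) : ℕ :=
  (u₀ - u₁) * ((a - 1) * u₀ + u₁) + a * u₀ * ((b - 1) * u₀ + u₁)

theorem even_add_bpsSignExponent {a b u₀ u₁ : ℕ} (ha : 0 < a) (hb : 0 < b) (hab : a.Coprime b)
    (hu : u₁ ≤ u₀) : Even ((a + b) * u₀ + u₁ + bpsSignExponent a b u₀ u₁) := by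
  have hodd : ¬(Even a ∧ Even b) := fun h =>
    Nat.not_coprime_of_dvd_of_dvd one_lt_two h.1.two_dvd h.2.two_dvd hab
  obtain ⟨a, rfl⟩ := Nat.exists_eq_add_one.mpr ha
  obtain ⟨b, rfl⟩ := Nat.exists_eq_add_one.mpr hb
  obtain ⟨v, rfl⟩ := Nat.exists_eq_add_of_le hu
  simp only [bpsSignExponent, Nat.add_sub_cancel, Nat.add_sub_cancel_left]
  simp only [Nat.even_add, Nat.even_mul, Nat.not_even_one, iff_false] at hodd ⊢
  tauto

theorem evalUnit_bpsTerm_mul (he : 0 < e) (hp : IsPrimitiveRoot ((x : DualNumber ℂ).fst ^ 2) e)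
    {a b u₀ u₁ : ℕ} (ha : 0 < a) (hb : 0 < b) (hu : u₁ ≤ u₀) :
    evalUnit x (bpsTerm a b (e * u₀) (e * u₁)) =
      ((-1) ^ ((a + b) * u₀ + u₁) *
        inl ((x : DualNumber ℂ).fst ^ e) ^ bpsSignExponent a b u₀ u₁) ^ e *
      (((a * u₀).choose (u₀ - u₁) * ((a + b - 1) * u₀ + u₁).choose (a * u₀) : ℕ) :
        DualNumber ℂ) := by
  obtain ⟨a, rfl⟩ := Nat.exists_eq_add_one.mpr ha
  obtain ⟨b, rfl⟩ := Nat.exists_eq_add_one.mpr hb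
  obtain ⟨v, rfl⟩ := Nat.exists_eq_add_of_le hu
  have h1 := evalUnit_symmBinom_mul he hp v (a * (u₁ + v) + u₁)
  have h2 := evalUnit_symmBinom_mul he hp ((a + 1) * (u₁ + v)) (b * (u₁ + v) + u₁)
  have e1 : (a + 1) * (u₁ + v) = v + (a * (u₁ + v) + u₁) := by ring
  have e2 : (a + 1 + (b + 1) - 1) * (u₁ + v) + u₁ =
      (a + 1) * (u₁ + v) + (b * (u₁ + v) + u₁) := by
    rw [show a + 1 + (b + 1) - 1 = a + 1 + b by lia]
    ring
  have e3 : (a + 1) * (e * (u₁ + v)) = e * ((a + 1) * (u₁ + v)) := by ring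
  have e4 : (a + 1 + (b + 1) - 1) * (e * (u₁ + v)) + e * u₁ =
      e * ((a + 1) * (u₁ + v)) + e * (b * (u₁ + v) + u₁) := by
    rw [← mul_add, ← e2]
    ring
  have e5 : e * v + e * (a * (u₁ + v) + u₁) = e * ((a + 1) * (u₁ + v)) := by ring
  rw [e5, ← e1] at h1
  rw [bpsTerm, bpsSignExponent, e3, e4, e2, ← Nat.mul_sub, Nat.add_sub_cancel_left, map_mul,
    map_mul, h1, h2]
  simp only [map_pow, map_neg, map_one, Nat.add_sub_cancel, Nat.cast_mul]
  ring

end Summand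

section MoebiusSum

open TrivSqZeroExt

variable {x : (DualNumber ℂ)ˣ} {e : ℕ}

theorem isPrimitiveRoot_fst_pow (he : 0 < e)
    (hp : IsPrimitiveRoot ((x : DualNumber ℂ).fst ^ 2) e) (k : ℕ) :
    IsPrimitiveRoot (((x ^ k : (DualNumber ℂ)ˣ) : DualNumber ℂ).fst ^ 2) (e / e.gcd k) := by
  rw [Units.val_pow_eq_pow_val, fst_pow, pow_right_comm]
  have := IsPrimitiveRoot.orderOf (((x : DualNumber ℂ).fst ^ 2) ^ k)
  rwa [(isOfFinOrder_iff_pow_eq_one.mpr ⟨e, he, hp.pow_eq_one⟩).orderOf_pow, ← hp.eq_orderOf] at this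

theorem mul_div_gcd_eq_lcm (e k : ℕ) : k * (e / e.gcd k) = e.lcm k := by
  rw [Nat.lcm, ← Nat.mul_div_assoc _ (Nat.gcd_dvd_left e k), mul_comm]

theorem div_gcd_dvd_div_iff {k n : ℕ} (hk : 0 < k) (hkn : k ∣ n) : e / e.gcd k ∣ n / k ↔ e ∣ n := by
  obtain ⟨n, rfl⟩ := hkn
  rw [Nat.mul_div_cancel_left n hk, ← Nat.mul_dvd_mul_iff_left hk, mul_div_gcd_eq_lcm,
    Nat.lcm_dvd_iff]
  simp

theorem fst_evalUnit_pow_bpsTerm_eq_zero (he : 0 < e)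
    (hp : IsPrimitiveRoot ((x : DualNumber ℂ).fst ^ 2) e)
    {a b d₀ d₁ k : ℕ} (ha : 0 < a) (hb : 0 < b) (hab : a.Coprime b) (hd : d₁ ≤ d₀) (hk : 0 < k)
    (hk₀ : k ∣ d₀) (hk₁ : k ∣ d₁)
    (h : e ∣ d₀ ∨ e ∣ (a + b - 1) * d₀ + d₁)
    (h' : ¬(e ∣ d₀ ∧ e ∣ (a + b - 1) * d₀ + d₁)) :
    (evalUnit (x ^ k) (bpsTerm a b (d₀ / k) (d₁ / k))).fst = 0 := by
  have hN : (a + b - 1) * (d₀ / k) + d₁ / k = ((a + b - 1) * d₀ + d₁) / k := by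
    rw [Nat.add_div_of_dvd_left hk₁, Nat.mul_div_assoc _ hk₀]
  have hkN : k ∣ (a + b - 1) * d₀ + d₁ := (hk₀.mul_left _).add hk₁
  refine fst_evalUnit_bpsTerm_eq_zero (isPrimitiveRoot_fst_pow he hp k) ha hb hab
    (Nat.div_le_div_right hd) ?_ ?_
  · rwa [hN, div_gcd_dvd_div_iff hk hk₀, div_gcd_dvd_div_iff hk hkN]
  · rwa [hN, div_gcd_dvd_div_iff hk hk₀, div_gcd_dvd_div_iff hk hkN]

theorem evalUnit_pow_bpsTerm (he : 0 < e)
    (hp : IsPrimitiveRoot ((x : DualNumber ℂ).fst ^ 2) e)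
    {a b k L u₀ u₁ : ℕ} (ha : 0 < a) (hb : 0 < b) (hu : u₁ ≤ u₀) (hk : 0 < k)
    (hL : e.lcm k = L) :
    evalUnit (x ^ k) (bpsTerm a b (L * u₀ / k) (L * u₁ / k)) =
      ((-1) ^ ((a + b) * u₀ + u₁) *
        inl ((x : DualNumber ℂ).fst ^ L) ^ bpsSignExponent a b u₀ u₁) ^ (L / k) *
      (((a * u₀).choose (u₀ - u₁) * ((a + b - 1) * u₀ + u₁).choose (a * u₀) : ℕ) :
        DualNumber ℂ) := by
  rw [← mul_div_gcd_eq_lcm] at hL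
  subst hL
  have h := evalUnit_bpsTerm_mul (Nat.div_pos (Nat.gcd_le_left k he) (Nat.gcd_pos_of_pos_left k he))
    (isPrimitiveRoot_fst_pow he hp k) ha hb hu
  rw [mul_assoc, mul_assoc, Nat.mul_div_cancel_left _ hk, Nat.mul_div_cancel_left _ hk,
    Nat.mul_div_cancel_left _ hk, h, Units.val_pow_eq_pow_val, fst_pow, pow_mul]

theorem lcm_prime_mul {p k : ℕ} (hpp : p.Prime) (hpe : p ∣ e) (hpk : ¬p ∣ k) :
    e.lcm (p * k) = e.lcm k := by
  refine Nat.dvd_antisymm (Nat.lcm_dvd (Nat.dvd_lcm_left _ _) ?_)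
    (Nat.lcm_dvd (Nat.dvd_lcm_left _ _) ((Dvd.intro_left p rfl).trans (Nat.dvd_lcm_right _ _)))
  exact ((hpp.coprime_iff_not_dvd).mpr hpk).mul_dvd_of_dvd_of_dvd
    (hpe.trans (Nat.dvd_lcm_left _ _)) (Nat.dvd_lcm_right _ _)

theorem fst_pow_eq_neg_one (he : 0 < e) (hp : IsPrimitiveRoot ((x : DualNumber ℂ).fst ^ 2) e)
    (h2 : 2 ∣ e) {k : ℕ} (hk : ¬2 ∣ k) : (x : DualNumber ℂ).fst ^ e.lcm k = -1 := by
  have h1 : (x : DualNumber ℂ).fst ^ e = -1 := by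
    refine (mul_self_eq_one_iff.mp (fst_pow_mul_self hp)).resolve_left fun h1 => ?_
    obtain ⟨c, rfl⟩ := h2
    rw [pow_mul, hp.pow_eq_one_iff_dvd] at h1
    exact absurd (Nat.le_of_dvd (by lia) h1) (by lia)
  have hodd : Odd (k / e.gcd k) := by
    rw [← Nat.not_even_iff_odd, even_iff_two_dvd]
    exact fun h => hk (h.trans (Nat.div_dvd_of_dvd (Nat.gcd_dvd_right e k)))
  rw [Nat.lcm, Nat.mul_div_assoc _ (Nat.gcd_dvd_right e k), pow_mul, h1, hodd.neg_one_pow]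

theorem evalUnit_pow_prime_mul_bpsTerm (he : 0 < e)
    (hp : IsPrimitiveRoot ((x : DualNumber ℂ).fst ^ 2) e)
    {a b d₀ d₁ k p : ℕ} (ha : 0 < a) (hb : 0 < b) (hab : a.Coprime b) (hd : d₁ ≤ d₀)
    (hpp : p.Prime) (hpe : p ∣ e) (hpk : ¬p ∣ k)
    (he₀ : e ∣ d₀) (he₁ : e ∣ d₁) (hk₀ : k ∣ d₀) (hk₁ : k ∣ d₁) :
    evalUnit (x ^ (p * k)) (bpsTerm a b (d₀ / (p * k)) (d₁ / (p * k))) =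
      evalUnit (x ^ k) (bpsTerm a b (d₀ / k) (d₁ / k)) := by
  have hk : 0 < k := Nat.pos_of_ne_zero fun h => hpk (h ▸ dvd_zero p)
  obtain ⟨u₀, rfl⟩ := Nat.lcm_dvd he₀ hk₀
  obtain ⟨u₁, rfl⟩ := Nat.lcm_dvd he₁ hk₁
  have hLpos : 0 < e.lcm k := Nat.lcm_pos he hk
  have hu : u₁ ≤ u₀ := Nat.le_of_mul_le_mul_left hd hLpos
  rw [evalUnit_pow_bpsTerm he hp ha hb hu (Nat.mul_pos hpp.pos hk) (lcm_prime_mul hpp hpe hpk),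
    evalUnit_pow_bpsTerm he hp ha hb hu hk rfl]
  congr 1
  have hdvd : p * k ∣ e.lcm k := lcm_prime_mul hpp hpe hpk ▸ Nat.dvd_lcm_right e (p * k)
  have hdiv : e.lcm k / k = p * (e.lcm k / (p * k)) := by
    obtain ⟨c, hc⟩ := hdvd
    rw [hc, Nat.mul_div_cancel_left _ (Nat.mul_pos hpp.pos hk), mul_comm p k, mul_assoc,
      Nat.mul_div_cancel_left _ hk]
  rw [hdiv, pow_mul]
  congr 1
  have hs : inl ((x : DualNumber ℂ).fst ^ e.lcm k) * inl ((x : DualNumber ℂ).fst ^ e.lcm k) =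
      (1 : DualNumber ℂ) := by
    obtain ⟨c, hc⟩ := Nat.dvd_lcm_left e k
    rw [← inl_mul, hc, pow_mul, ← mul_pow, fst_pow_mul_self hp, one_pow, inl_one]
  rcases hpp.eq_two_or_odd' with rfl | hodd
  · rw [fst_pow_eq_neg_one he hp hpe hpk, inl_neg, inl_one, ← pow_add,
      (even_add_bpsSignExponent ha hb hab hu).neg_one_pow, one_pow]
  · obtain ⟨c, rfl⟩ := hodd
    rw [pow_succ, pow_mul, mul_pow, ← pow_mul, mul_comm _ 2, pow_mul, ← pow_mul _ _ 2,
      mul_comm _ 2, pow_mul, sq (inl _), hs]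
    simp

end MoebiusSum

theorem bps_integrality_Y2ab (a b d₀ d₁ : ℕ) (ha : 0 < a) (hb : 0 < b)
    (hab : Nat.Coprime a b) (hd₀ : 1 ≤ d₀) (hd₁ : d₁ ≤ d₀) :
    qint (d₀ : ℤ) * qint (((a + b - 1) * d₀ + d₁ : ℕ) : ℤ) ∣
      qint 1 ^ 2 *
        ∑ k ∈ (Nat.gcd d₀ d₁).divisors,
          ((moebius k : ℤ) : LaurentPolynomial ℤ) *
            (-1) ^ (((a + b) * d₀ + d₁) / k) *
            symmBinom (k : ℤ) (a * d₀ / k) ((d₀ - d₁) / k) *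
            symmBinom (k : ℤ) (((a + b - 1) * d₀ + d₁) / k) (a * d₀ / k) := by
  have hNpos : 0 < (a + b - 1) * d₀ + d₁ := Nat.add_pos_left (Nat.mul_pos (by lia) hd₀) _
  refine qint_mul_qint_dvd hd₀ hNpos _ fun x hx => ?_
  have hg : Nat.gcd d₀ d₁ ≠ 0 := (Nat.gcd_pos_of_pos_left _ hd₀).ne'
  have hsum : evalUnit x (∑ k ∈ (Nat.gcd d₀ d₁).divisors,
      ((moebius k : ℤ) : LaurentPolynomial ℤ) *
        (-1) ^ (((a + b) * d₀ + d₁) / k) *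
        symmBinom (k : ℤ) (a * d₀ / k) ((d₀ - d₁) / k) *
        symmBinom (k : ℤ) (((a + b - 1) * d₀ + d₁) / k) (a * d₀ / k)) =
      ∑ k ∈ (Nat.gcd d₀ d₁).divisors, ((moebius k : ℤ) : DualNumber ℂ) *
        evalUnit (x ^ k) (bpsTerm a b (d₀ / k) (d₁ / k)) := by
    rw [map_sum]
    refine sum_congr rfl fun k hk => ?_
    have hkg := Nat.dvd_of_mem_divisors hk
    obtain ⟨y₀, hy₀⟩ := hkg.trans (Nat.gcd_dvd_left d₀ d₁)
    obtain ⟨y₁, hy₁⟩ := hkg.trans (Nat.gcd_dvd_right d₀ d₁)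
    have hkpos : 0 < k := Nat.pos_of_mem_divisors hk
    have h1 : ((a + b) * d₀ + d₁) / k = (a + b) * y₀ + y₁ := by
      rw [hy₀, hy₁, show (a + b) * (k * y₀) + k * y₁ = k * ((a + b) * y₀ + y₁) by ring,
        Nat.mul_div_cancel_left _ hkpos]
    have h2 : ((a + b - 1) * d₀ + d₁) / k = (a + b - 1) * y₀ + y₁ := by
      rw [hy₀, hy₁, show (a + b - 1) * (k * y₀) + k * y₁ = k * ((a + b - 1) * y₀ + y₁) by ring,
        Nat.mul_div_cancel_left _ hkpos]
    have h3 : a * d₀ / k = a * y₀ := by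
      rw [hy₀, mul_left_comm, Nat.mul_div_cancel_left _ hkpos]
    have h4 : (d₀ - d₁) / k = y₀ - y₁ := by
      rw [hy₀, hy₁, ← Nat.mul_sub, Nat.mul_div_cancel_left _ hkpos]
    rw [h1, h2, h3, h4, hy₀, hy₁, Nat.mul_div_cancel_left _ hkpos, Nat.mul_div_cancel_left _ hkpos]
    simp only [bpsTerm, map_mul, map_pow, map_neg, map_one, map_intCast,
      evalUnit_symmBinom_eq_zpow x k, zpow_natCast, mul_assoc]
  rw [hsum]
  have hprim := IsPrimitiveRoot.orderOf ((x : DualNumber ℂ).fst ^ 2)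
  set e := orderOf ((x : DualNumber ℂ).fst ^ 2) with he_def
  have he1 : e ≠ 1 := fun h => hx (orderOf_eq_one_iff.mp h)
  rw [hprim.pow_eq_one_iff_dvd, hprim.pow_eq_one_iff_dvd]
  have hboth : e ∣ d₀ → e ∣ (a + b - 1) * d₀ + d₁ →
      ∑ k ∈ (Nat.gcd d₀ d₁).divisors, ((moebius k : ℤ) : DualNumber ℂ) *
        evalUnit (x ^ k) (bpsTerm a b (d₀ / k) (d₁ / k)) = 0 := by
    intro he₀ heN
    have he₁ : e ∣ d₁ := (Nat.dvd_add_right (he₀.mul_left _)).mp heN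
    have hpe := Nat.minFac_dvd e
    refine sum_moebius_mul_eq_zero hg (Nat.minFac_prime he1) (hpe.trans (Nat.dvd_gcd he₀ he₁)) _ ?_
    intro k hkg hpk
    have hkg := (Dvd.intro_left _ rfl).trans hkg
    exact evalUnit_pow_prime_mul_bpsTerm (Nat.pos_of_dvd_of_pos he₀ hd₀) hprim ha hb hab hd₁
      (Nat.minFac_prime he1) hpe hpk he₀ he₁ (hkg.trans (Nat.gcd_dvd_left _ _))
      (hkg.trans (Nat.gcd_dvd_right _ _))
  refine ⟨hboth, fun hor => ?_⟩
  by_cases hand : e ∣ d₀ ∧ e ∣ (a + b - 1) * d₀ + d₁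
  · rw [hboth hand.1 hand.2, TrivSqZeroExt.fst_zero]
  · have he : 0 < e := hor.elim (Nat.pos_of_dvd_of_pos · hd₀) (Nat.pos_of_dvd_of_pos · hNpos)
    rw [TrivSqZeroExt.fst_sum]
    refine sum_eq_zero fun k hk => ?_
    have hkg := Nat.dvd_of_mem_divisors hk
    rw [TrivSqZeroExt.fst_mul, fst_evalUnit_pow_bpsTerm_eq_zero he hprim ha hb hab hd₁
      (Nat.pos_of_mem_divisors hk) (hkg.trans (Nat.gcd_dvd_left _ _))
      (hkg.trans (Nat.gcd_dvd_right _ _)) hor hand, mul_zero]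
end
end

section
/- Let a and b be coprime positive integers and let d₀ ≥ 1 and 0 ≤ d₁ ≤ d₀ be integers; let g = gcd(d₀,d₁) (with gcd(d₀,0) = d₀). Then d₀·((a+b−1)d₀+d₁) divides Σ_{k∣g} μ(k)·(−1)^{((a+b)d₀+d₁)/k} · C(ad₀/k, (d₀−d₁)/k) · C(((a+b−1)d₀+d₁)/k, ad₀/k) in ℤ. (This is the genus-zero specialisation of Theorem 2.3 for Y^{[2]}_{(a,b)}: the Klemm–Pandharipande-type BPS number Ω_{(d₀,d₁)}(Y^{[2]}_{(a,b)}) is an integer.) -/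
/-!
STATEMENT 3: genus-zero BPS integrality for Y^{[2]}_{(a,b)}:
d₀·((a+b−1)d₀+d₁) divides
Σ_{k∣gcd(d₀,d₁)} μ(k)·(−1)^{((a+b)d₀+d₁)/k} · C(ad₀/k, (d₀−d₁)/k) · C(((a+b−1)d₀+d₁)/k, ad₀/k).
-/

open Finset ArithmeticFunction

/-- The trinomial coefficient `(x + y + z)! / (x! y! z!)`, as a product of two binomials. -/
def trinomial (x y z : ℕ) : ℕ := (x + y).choose x * (x + y + z).choose (x + y)

lemma trinomial_swap (x y z : ℕ) : trinomial x y z = trinomial x z y := by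
  have h : ∀ y z, trinomial x y z * (x.factorial * y.factorial * z.factorial)
      = (x + y + z).factorial := by
    intro y z
    have h₁ := Nat.add_choose_mul_factorial_mul_factorial x y
    have h₂ := Nat.add_choose_mul_factorial_mul_factorial (x + y) z
    rw [← h₂, ← h₁, trinomial, Nat.choose_symm_add, Nat.choose_symm_add (a := x + y)]
    ring
  have hpos : 0 < x.factorial * y.factorial * z.factorial := by positivity
  apply Nat.eq_of_mul_eq_mul_right hpos
  rw [h y z, mul_right_comm x.factorial, h z y, add_right_comm]

lemma Nat.dvd_gcd_mul_choose (n k : ℕ) : n ∣ n.gcd k * n.choose k := by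
  rw [← Nat.gcd_mul_right]
  refine Nat.dvd_gcd (dvd_mul_right _ _) ?_
  rcases k with _ | k
  · simp
  rcases n with _ | n
  · simp
  exact ⟨n.choose k, by rw [mul_comm (k + 1), Nat.add_one_mul_choose_eq]⟩

lemma mul_dvd_mul_sq_mul_trinomial {x y z a b d : ℕ} (ha : 0 < a)
    (hxy : x + y = a * d) (hxz : x + z = b * d) :
    d * (x + y + z) ∣ a * (d.gcd x ^ 2 * trinomial x y z) := by
  have h₁ : (x + y).gcd x ∣ a * d.gcd x := by
    rw [← Nat.gcd_mul_left, hxy]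
    exact Nat.gcd_dvd_gcd_mul_left_right _ _ _
  have h₂ : (x + y + z).gcd (x + y) ∣ a * d.gcd x := by
    set t := (x + y + z).gcd (x + y)
    have hxy' : t ∣ x + y := Nat.gcd_dvd_right _ _
    have hz : t ∣ z := (Nat.dvd_add_right hxy').1 (Nat.gcd_dvd_left _ _)
    rw [← Nat.gcd_mul_left, ← hxy]
    refine Nat.dvd_gcd hxy' ((Nat.dvd_add_left (hz.mul_left a)).1 ?_)
    rw [← mul_add, hxz, mul_left_comm, ← hxy]
    exact hxy'.mul_left b
  have h := mul_dvd_mul ((Nat.dvd_gcd_mul_choose (x + y) x).trans (mul_dvd_mul_right h₁ _))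
    ((Nat.dvd_gcd_mul_choose (x + y + z) (x + y)).trans (mul_dvd_mul_right h₂ _))
  apply Nat.dvd_of_mul_dvd_mul_left ha
  calc a * (d * (x + y + z)) = (x + y) * (x + y + z) := by rw [← mul_assoc, ← hxy]
    _ ∣ _ := h
    _ = _ := by rw [trinomial]; ring

lemma mul_dvd_sq_mul_trinomial {x y z a b d : ℕ} (ha : 0 < a) (hb : 0 < b)
    (hab : a.Coprime b) (hxy : x + y = a * d) (hxz : x + z = b * d) :
    d * (x + y + z) ∣ d.gcd x ^ 2 * trinomial x y z := by
  have h₁ := mul_dvd_mul_sq_mul_trinomial ha hxy hxz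
  have h₂ := mul_dvd_mul_sq_mul_trinomial hb hxz hxy
  rw [trinomial_swap x z y, add_right_comm] at h₂
  have h := Nat.dvd_gcd h₁ h₂
  rwa [Nat.gcd_mul_right, hab.gcd_eq_one, one_mul] at h

/-- The product of `m + i` over the `i < n` not divisible by `p`. -/
def shiftedProd (p m n : ℕ) : ℕ := ∏ i ∈ range n, if p ∣ i then 1 else m + i

lemma shiftedProd_add {p : ℕ} (m l : ℕ) :
    shiftedProd p 0 (p * (m + l)) = shiftedProd p 0 (p * m) * shiftedProd p (p * m) (p * l) := by
  simp only [shiftedProd, mul_add, prod_range_add, zero_add]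
  congr 1
  refine prod_congr rfl fun i _ => ?_
  simp [Nat.dvd_add_right (dvd_mul_right p m)]

lemma factorial_prime_mul {p : ℕ} (hp : p.Prime) (n : ℕ) :
    (p * n).factorial = p ^ n * n.factorial * shiftedProd p 0 (p * n) := by
  induction n with
  | zero => simp [shiftedProd]
  | succ n ih =>
    obtain ⟨q, rfl⟩ : ∃ q, p = q + 1 := ⟨p - 1, by have := hp.pos; omega⟩
    have hblock : shiftedProd (q + 1) ((q + 1) * n) ((q + 1) * 1)
        = ((q + 1) * n + 1).ascFactorial q := by
      rw [shiftedProd, mul_one, prod_range_succ', Nat.ascFactorial_eq_prod_range]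
      simp only [dvd_zero, if_true, mul_one]
      refine prod_congr rfl fun i hi => ?_
      rw [if_neg (Nat.not_dvd_of_pos_of_lt i.succ_pos (by simpa using hi))]
      ring
    rw [shiftedProd_add, hblock, show (q + 1) * (n + 1) = (q + 1) * n + q + 1 by ring,
      Nat.factorial_succ, ← Nat.factorial_mul_ascFactorial, ih, Nat.factorial_succ]
    ring

lemma shiftedProd_zero_pos (p n : ℕ) : 0 < shiftedProd p 0 n := by
  refine prod_pos fun i _ => ?_
  split_ifs with h
  · exact one_pos
  · rw [zero_add]
    exact Nat.pos_of_ne_zero fun h0 => h (h0 ▸ dvd_zero p)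

lemma coprime_shiftedProd_zero {p : ℕ} (hp : p.Prime) (n : ℕ) :
    p.Coprime (shiftedProd p 0 n) := by
  refine Nat.Coprime.prod_right fun i _ => ?_
  split_ifs with h
  · exact Nat.coprime_one_right p
  · rwa [zero_add, hp.coprime_iff_not_dvd]

lemma choose_prime_mul_mul_shiftedProd {p : ℕ} (hp : p.Prime) (m l : ℕ) :
    (p * (m + l)).choose (p * m) * shiftedProd p 0 (p * l)
      = (m + l).choose m * shiftedProd p (p * m) (p * l) := by
  have h₁ := Nat.add_choose_mul_factorial_mul_factorial (p * m) (p * l)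
  have h₂ := Nat.add_choose_mul_factorial_mul_factorial m l
  rw [← mul_add, factorial_prime_mul hp, factorial_prime_mul hp, factorial_prime_mul hp,
    shiftedProd_add, ← h₂] at h₁
  have hpos : 0 < p ^ (m + l) * m.factorial * l.factorial * shiftedProd p 0 (p * m) := by
    have := shiftedProd_zero_pos p (p * m)
    have := hp.pos
    positivity
  apply Nat.eq_of_mul_eq_mul_right hpos
  rw [Nat.choose_symm_add, mul_add, Nat.choose_symm_add, ← mul_add]
  rw [pow_add] at h₁ ⊢
  linarith

lemma prod_range_two_mul_add_one {M : Type*} [CommMonoid M] (F : ℕ → M) (h : ℕ) :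
    ∏ i ∈ range (2 * h + 1), F i = F 0 * ∏ i ∈ range h, (F (i + 1) * F (2 * h + 1 - (i + 1))) := by
  rw [show 2 * h + 1 = (h + 1) + h by ring, prod_range_add, prod_range_succ', prod_mul_distrib,
    ← prod_range_reflect (fun i => F (h + 1 + i)), mul_comm _ (F 0), mul_assoc]
  congr 2
  refine prod_congr rfl fun i hi => congrArg F ?_
  have := mem_range.1 hi
  omega

lemma prod_range_two_mul_add_two {M : Type*} [CommMonoid M] (F : ℕ → M) (h : ℕ) :
    ∏ i ∈ range (2 * h + 2), F i
      = F 0 * (∏ i ∈ range h, (F (i + 1) * F (2 * h + 2 - (i + 1)))) * F (h + 1) := by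
  rw [show 2 * h + 2 = (h + 1) + 1 + h by ring, prod_range_add, prod_range_succ,
    prod_range_succ', prod_mul_distrib, ← prod_range_reflect (fun i => F (h + 1 + 1 + i)),
    mul_comm _ (F 0), mul_right_comm, mul_assoc (F 0)]
  congr 3
  refine prod_congr rfl fun i hi => congrArg F ?_
  have := mem_range.1 hi
  omega

lemma shiftedProd_pair_modEq {p r m n i : ℕ} (hpn : p ∣ n) (hm : p ^ r ∣ m) (hn : p ^ r ∣ n)
    (hi : i ≤ n) :
    (if p ∣ i then 1 else m + i) * (if p ∣ n - i then 1 else m + (n - i))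
      ≡ (if p ∣ i then 1 else 0 + i) * (if p ∣ n - i then 1 else 0 + (n - i))
        [MOD p ^ (2 * r)] := by
  simp only [Nat.dvd_sub_iff_right hi hpn]
  split_ifs
  · rfl
  · obtain ⟨j, rfl⟩ := Nat.exists_eq_add_of_le hi
    rw [Nat.add_sub_cancel_left, show (m + i) * (m + j) = (0 + i) * (0 + j) + m * (m + (i + j)) by
      ring, two_mul, pow_add]
    exact (Nat.modEq_zero_iff_dvd.2 (mul_dvd_mul hm (dvd_add hm hn))).add_left _

lemma shiftedProd_middle_modEq {p r m l h : ℕ} (hp : p.Prime) (hl : p ^ r ∣ p * l)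
    (hh : p * l = 2 * h) :
    ((if p ∣ h then 1 else p * m + h : ℕ) : ℤ)
      ≡ (-1) ^ ((p - 1) * (m * l)) * (if p ∣ h then 1 else 0 + h : ℕ) [ZMOD p ^ (2 * r)] := by
  rcases hp.eq_two_or_odd' with rfl | hodd
  · obtain rfl : l = h := by omega
    rcases Nat.even_or_odd l with he | ho
    · have : Even (m * l) := he.mul_left m
      simp [he.two_dvd, this.neg_one_pow]
    · have hr : r ≤ 1 := by
        by_contra! hr
        have h4 : 2 ^ 2 ∣ 2 * l := (pow_dvd_pow 2 hr).trans hl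
        obtain ⟨c, rfl⟩ := ho
        omega
      have h2l : ¬ 2 ∣ l := by rw [← even_iff_two_dvd]; simpa using ho
      have h4 : ((2 : ℕ) : ℤ) ^ (2 * r) ∣ 4 := by
        simpa using pow_dvd_pow (2 : ℤ) (by omega : 2 * r ≤ 2)
      refine Int.ModEq.of_dvd h4 ?_
      rw [if_neg h2l, if_neg h2l, pow_mul, pow_mul]
      obtain ⟨c, rfl⟩ := ho
      rcases Nat.even_or_odd' m with ⟨s, rfl | rfl⟩
      · simp [Int.modEq_iff_dvd]
        exact ⟨s, by ring⟩
      · simp [Int.modEq_iff_dvd, pow_add]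
        exact ⟨-s - c - 1, by ring⟩
  · have hph : p ∣ h := by
      have : p ∣ 2 * h := hh ▸ dvd_mul_right p l
      exact (Nat.Coprime.dvd_of_dvd_mul_left (by simpa using hodd) this)
    have he : Even ((p - 1) * (m * l)) := (Nat.Odd.sub_odd hodd odd_one).mul_right _
    simp [hph, he.neg_one_pow]

lemma shiftedProd_modEq {p r m l : ℕ} (hp : p.Prime) (hm : p ^ r ∣ p * m) (hl : p ^ r ∣ p * l) :
    (shiftedProd p (p * m) (p * l) : ℤ)
      ≡ (-1) ^ ((p - 1) * (m * l)) * shiftedProd p 0 (p * l) [ZMOD p ^ (2 * r)] := by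
  have hpair : ∀ h ≤ p * l, (∏ i ∈ range h, ((if p ∣ i + 1 then 1 else p * m + (i + 1)) *
        (if p ∣ p * l - (i + 1) then 1 else p * m + (p * l - (i + 1)))) : ℕ)
      ≡ (∏ i ∈ range h, ((if p ∣ i + 1 then 1 else 0 + (i + 1)) *
        (if p ∣ p * l - (i + 1) then 1 else 0 + (p * l - (i + 1)))) : ℕ) [MOD p ^ (2 * r)] := by
    intro h hh
    refine Nat.ModEq.prod fun i hi => ?_
    exact shiftedProd_pair_modEq (dvd_mul_right p l) hm hl (by have := mem_range.1 hi; omega)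
  rcases Nat.even_or_odd' (p * l) with ⟨h, hh | hh⟩
  · rcases h with _ | h
    · have hl0 : l = 0 := by
        have := hp.pos
        simpa [this.ne'] using hh
      subst hl0
      simp [shiftedProd]
    · have hmid := shiftedProd_middle_modEq (m := m) hp hl hh
      have := Int.natCast_modEq_iff.2 (hpair h (by omega))
      rw [hh] at this ⊢
      unfold shiftedProd
      rw [mul_add, mul_one, prod_range_two_mul_add_two, prod_range_two_mul_add_two]
      push_cast at this hmid ⊢
      rw [mul_add, mul_one] at this
      push_cast at this
      simp only [dvd_zero, if_true, one_mul]
      rw [mul_left_comm]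
      exact this.mul hmid
  · have hodd : Odd p := Nat.Odd.of_mul_left (n := l) ⟨h, hh⟩
    have he : Even ((p - 1) * (m * l)) := (Nat.Odd.sub_odd hodd odd_one).mul_right _
    have := Int.natCast_modEq_iff.2 (hpair h (by omega))
    rw [he.neg_one_pow, one_mul, hh] at *
    unfold shiftedProd
    rw [prod_range_two_mul_add_one, prod_range_two_mul_add_one]
    simpa using this

lemma trinomial_prime_mul_modEq {p r c x y z : ℕ} (hp : p.Prime) (hx : p ^ r ∣ p * x)
    (hy : p ^ r ∣ p * y) (hz : p ^ r ∣ p * z) (hc : c ∣ trinomial x y z) :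
    (p ^ (2 * r) * c : ℤ) ∣ shiftedProd p 0 (p * y) * shiftedProd p 0 (p * z) *
      (trinomial (p * x) (p * y) (p * z)
        - (-1) ^ ((p - 1) * (x * y + (x + y) * z)) * trinomial x y z) := by
  have h₁ := choose_prime_mul_mul_shiftedProd hp x y
  have h₂ := choose_prime_mul_mul_shiftedProd hp (x + y) z
  have h₃ := (shiftedProd_modEq hp hx hy).mul
    (shiftedProd_modEq hp (by rw [mul_add]; exact dvd_add hx hy) hz)
  have hT : trinomial (p * x) (p * y) (p * z) * (shiftedProd p 0 (p * y) * shiftedProd p 0 (p * z))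
      = trinomial x y z * (shiftedProd p (p * x) (p * y) *
        shiftedProd p (p * (x + y)) (p * z)) := by
    rw [trinomial, trinomial, ← mul_add, ← mul_add, mul_mul_mul_comm, h₁, h₂, mul_mul_mul_comm]
  have h := mul_dvd_mul h₃.symm.dvd (Int.natCast_dvd_natCast.2 hc)
  refine h.trans (dvd_of_eq ?_)
  zify at hT
  rw [mul_sub, mul_comm (_ * _) (trinomial (p * x) _ _ : ℤ), hT, mul_add (p - 1), pow_add]
  ring

lemma sum_divisors_prime_pow_mul_moebius {p r h : ℕ} (hp : p.Prime) (hph : p.Coprime h)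
    (f : ℕ → ℤ) :
    ∑ k ∈ (p ^ (r + 1) * h).divisors, moebius k * f (p ^ (r + 1) * h / k)
      = ∑ k ∈ h.divisors, moebius k * (f (p ^ (r + 1) * (h / k)) - f (p ^ r * (h / k))) := by
  have hcop : (p ^ (r + 1)).Coprime h := hph.pow_left _
  have hz : ∀ j ∈ range r, ∀ k ∈ h.divisors,
      moebius (p ^ (j + 1 + 1) * k) * f (p ^ (r + 1) * h / (p ^ (j + 1 + 1) * k)) = 0 := by
    intro j _ k _
    rw [moebius_eq_zero_of_not_squarefree, zero_mul]
    intro hsq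
    exact hp.not_isUnit (hsq p ⟨p ^ j * k, by ring⟩)
  rw [Nat.divisors_mul, mul_def, sum_image hcop.mul_injOn_divisors, sum_product,
    Nat.sum_divisors_prime_pow hp, sum_range_succ', sum_range_succ',
    sum_eq_zero fun j hj => sum_eq_zero (hz j hj), zero_add, ← sum_add_distrib]
  refine sum_congr rfl fun k hk => ?_
  have hkh := Nat.dvd_of_mem_divisors hk
  have hpk : p.Coprime k := hph.coprime_dvd_right hkh
  have hdiv : p ^ (r + 1) * h / (p * k) = p ^ r * (h / k) := by
    rw [pow_succ', mul_assoc, Nat.mul_div_mul_left _ _ hp.pos, Nat.mul_div_assoc _ hkh]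
  simp only [zero_add, pow_one, pow_zero, one_mul]
  rw [isMultiplicative_moebius.map_mul_of_coprime hpk, moebius_apply_prime hp, hdiv,
    Nat.mul_div_assoc _ hkh]
  ring

lemma sq_mul_dvd_sum_moebius {g c : ℕ} (hg : 0 < g) {f : ℕ → ℤ}
    (hc : ∀ e, 0 < e → (c : ℤ) ∣ f e)
    (hf : ∀ p r e : ℕ, p.Prime → 0 < e → p ^ r ∣ p * e → ∀ t, p ^ t ∣ p ^ (2 * r) * c →
      (p ^ t : ℤ) ∣ f (p * e) - f e) :
    ((g ^ 2 * c : ℕ) : ℤ) ∣ ∑ k ∈ g.divisors, moebius k * f (g / k) := by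
  rw [Int.natCast_dvd, Nat.dvd_iff_prime_pow_dvd_dvd]
  intro p t hp ht
  rw [← Int.natCast_dvd, Nat.cast_pow]
  obtain ⟨r, h, hph, rfl⟩ := Nat.exists_eq_pow_mul_and_not_dvd hg.ne' p hp.ne_one
  have hcop : p.Coprime h := (hp.coprime_iff_not_dvd).2 hph
  have ht' : p ^ t ∣ p ^ (2 * r) * c := by
    refine Nat.Coprime.dvd_of_dvd_mul_left (m := h ^ 2) (hcop.pow t 2) ?_
    convert ht using 1
    ring
  have hpos : ∀ k ∈ h.divisors, 0 < h / k := fun k hk =>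
    Nat.div_pos (Nat.divisor_le hk) (Nat.pos_of_mem_divisors hk)
  rcases r with _ | r
  · simp only [pow_zero, one_mul, mul_zero] at ht' ⊢
    refine dvd_sum fun k hk => Dvd.dvd.mul_left ?_ _
    exact (by exact_mod_cast ht' : (p ^ t : ℤ) ∣ c).trans (hc _ (hpos k hk))
  · rw [sum_divisors_prime_pow_mul_moebius hp hcop]
    refine dvd_sum fun k hk => Dvd.dvd.mul_left ?_ _
    have := hf p (r + 1) (p ^ r * (h / k)) hp (Nat.mul_pos (pow_pos hp.pos r) (hpos k hk))
      ⟨h / k, by ring⟩ t ht'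
    rwa [← mul_assoc, ← pow_succ'] at this

lemma neg_one_pow_sub_one_mul (p : ℕ) {m n : ℕ} (h : Even (m + n)) :
    (-1 : ℤ) ^ ((p - 1) * m) = (-1) ^ ((p - 1) * n) := by
  have h' : Even ((p - 1) * m + (p - 1) * n) := by
    rw [← mul_add]
    exact h.mul_left _
  rw [Nat.even_add] at h'
  rcases Nat.even_or_odd ((p - 1) * m) with he | ho
  · rw [he.neg_one_pow, (h'.1 he).neg_one_pow]
  · rw [ho.neg_one_pow, Odd.neg_one_pow]
    rw [← Nat.not_even_iff_odd] at ho ⊢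
    rwa [← h']

lemma signed_trinomial_prime_mul {p r c x y z s t : ℕ} (hp : p.Prime) (hx : p ^ r ∣ p * x)
    (hy : p ^ r ∣ p * y) (hz : p ^ r ∣ p * z) (hc : c ∣ trinomial x y z)
    (hs : Even (x * y + (x + y) * z + s)) (ht : p ^ t ∣ p ^ (2 * r) * c) :
    (p ^ t : ℤ) ∣ (-1) ^ (p * s) * trinomial (p * x) (p * y) (p * z)
      - (-1) ^ s * trinomial x y z := by
  have h := trinomial_prime_mul_modEq hp hx hy hz hc
  have hcop : IsCoprime (p ^ t : ℤ) (shiftedProd p 0 (p * y) * shiftedProd p 0 (p * z)) := by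
    exact_mod_cast Nat.isCoprime_iff_coprime.2
      (Nat.Coprime.pow_left t
        ((coprime_shiftedProd_zero hp (p * y)).mul_right (coprime_shiftedProd_zero hp (p * z))))
  have h' := hcop.dvd_of_dvd_mul_left ((by exact_mod_cast ht :
    (p ^ t : ℤ) ∣ p ^ (2 * r) * c).trans h)
  rw [neg_one_pow_sub_one_mul p hs] at h'
  have hsq : (-1 : ℤ) ^ ((p - 1) * s) * (-1) ^ ((p - 1) * s) = 1 := by
    rw [← mul_pow]
    simp
  have hps : (-1 : ℤ) ^ (p * s) = (-1) ^ s * (-1) ^ ((p - 1) * s) := by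
    rw [← pow_add]
    congr 1
    obtain ⟨q, rfl⟩ : ∃ q, p = q + 1 := ⟨p - 1, by have := hp.pos; omega⟩
    rw [Nat.add_sub_cancel]
    ring
  refine (h'.mul_left ((-1) ^ (p * s))).trans (dvd_of_eq ?_)
  rw [hps]
  linear_combination (-(-1) ^ s * (trinomial x y z : ℤ)) * hsq

lemma even_trinomial_sign_exponent {a b : ℕ} (e v w : ℕ) (hab : (a + 1).Coprime (b + 1)) :
    Even (w * e * ((a * (v + w) + v) * e)
      + (w * e + (a * (v + w) + v) * e) * ((b * (v + w) + v) * e)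
      + ((a + 1 + (b + 1)) * (v + w) + v) * e) := by
  have hab' : ¬ (Even (a + 1) ∧ Even (b + 1)) := fun ⟨h₁, h₂⟩ =>
    Nat.not_coprime_of_dvd_of_dvd one_lt_two h₁.two_dvd h₂.two_dvd hab
  simp only [Nat.even_add, Nat.even_mul, Nat.not_even_one] at hab' ⊢
  by_cases ha : Even a <;> by_cases hb : Even b <;> by_cases hv : Even v <;>
    by_cases hw : Even w <;> by_cases he : Even e <;> simp only [ha, hb, hv, hw, he] at hab' ⊢ <;>
    simp at hab' ⊢

theorem bps_integrality_Y2ab_genus_zero (a b d₀ d₁ : ℕ) (ha : 0 < a) (hb : 0 < b)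
    (hab : Nat.Coprime a b) (hd₀ : 1 ≤ d₀) (hd₁ : d₁ ≤ d₀) :
    ((d₀ * ((a + b - 1) * d₀ + d₁) : ℕ) : ℤ) ∣
      ∑ k ∈ (Nat.gcd d₀ d₁).divisors,
        (moebius k : ℤ) * (-1) ^ (((a + b) * d₀ + d₁) / k) *
          ((a * d₀ / k).choose ((d₀ - d₁) / k) : ℤ) *
          (((((a + b - 1) * d₀ + d₁) / k)).choose (a * d₀ / k) : ℤ) := by
  have hg : 0 < d₀.gcd d₁ := Nat.gcd_pos_of_pos_left _ hd₀
  obtain ⟨u, v, huv, hu, hv⟩ := Nat.exists_coprime d₀ d₁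
  set g := d₀.gcd d₁
  clear_value g
  subst hu hv
  obtain ⟨w, rfl⟩ := Nat.exists_eq_add_of_le (Nat.le_of_mul_le_mul_right hd₁ hg)
  obtain ⟨a, rfl⟩ : ∃ a', a = a' + 1 := ⟨a - 1, by omega⟩
  obtain ⟨b, rfl⟩ : ∃ b', b = b' + 1 := ⟨b - 1, by omega⟩
  set y := a * (v + w) + v with hy
  set z := b * (v + w) + v with hz
  set s := (a + 1 + (b + 1)) * (v + w) + v with hs
  have hcop : (v + w).Coprime w := by
    simpa [Nat.coprime_comm] using huv
  have hc : ∀ e, 0 < e → (v + w) * (w + y + z) ∣ trinomial (w * e) (y * e) (z * e) := by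
    intro e he
    have h := mul_dvd_sq_mul_trinomial (x := w * e) (y := y * e) (z := z * e) (d := (v + w) * e)
      ha hb hab (by rw [hy]; ring) (by rw [hz]; ring)
    rw [Nat.gcd_mul_right, hcop.gcd_eq_one, one_mul] at h
    apply Nat.dvd_of_mul_dvd_mul_left (pow_pos he 2)
    convert h using 1
    ring
  have key := sq_mul_dvd_sum_moebius hg (c := (v + w) * (w + y + z))
    (f := fun e => (-1) ^ (s * e) * (trinomial (w * e) (y * e) (z * e) : ℤ))
    (fun e he => (Int.natCast_dvd_natCast.2 (hc e he)).mul_left _) (by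
      intro p r e hp he hr t ht
      have hdvd : ∀ x, p ^ r ∣ p * (x * e) := fun x => by
        rw [mul_left_comm]
        exact hr.mul_left x
      have hpar : Even (w * e * (y * e) + (w * e + y * e) * (z * e) + s * e) :=
        even_trinomial_sign_exponent e v w hab
      simpa only [mul_left_comm p] using
        signed_trinomial_prime_mul hp (hdvd w) (hdvd y) (hdvd z) (hc e he) hpar ht)
  have hsub : a + 1 + (b + 1) - 1 = a + b + 1 := by omega
  rw [hsub]
  convert key using 1
  · rw [hy, hz]
    congr 1
    ring
  · refine sum_congr rfl fun k hk => ?_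
    have hkg := Nat.dvd_of_mem_divisors hk
    have e₁ : ((a + 1 + (b + 1)) * ((v + w) * g) + v * g) / k = s * (g / k) := by
      rw [← Nat.mul_div_assoc _ hkg, hs]
      congr 1
      ring
    have e₂ : (a + 1) * ((v + w) * g) / k = w * (g / k) + y * (g / k) := by
      rw [← add_mul, ← Nat.mul_div_assoc _ hkg, hy]
      congr 1
      ring
    have e₃ : ((v + w) * g - v * g) / k = w * (g / k) := by
      rw [← Nat.mul_div_assoc _ hkg, ← Nat.sub_mul, Nat.add_sub_cancel_left]
    have e₄ : ((a + b + 1) * ((v + w) * g) + v * g) / k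
        = w * (g / k) + y * (g / k) + z * (g / k) := by
      rw [← add_mul, ← add_mul, ← Nat.mul_div_assoc _ hkg, hy, hz]
      congr 1
      ring
    rw [e₁, e₂, e₃, e₄, trinomial]
    push_cast
    ring
end
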